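/- With notation as in the basis construction: fix ε_1,…,ε_N ∈ {0,1}^g (N = 1 + g(g+1)/2) such that the N×N determinant g_{ε_1,…,ε_N}(τ₀) := det(Θ[ε_i](τ₀,0), ∂Θ[ε_i]/∂τ_{11}(τ₀,0), …, ∂Θ[ε_i]/∂τ_{gg}(τ₀,0))_{i=1..N} is nonzero. For each ε ∉ {ε_1,…,ε_N}, define f_ε(z) as the (N+1)×(N+1) determinant whose first N rows are (Θ[ε_i](τ₀,z), Θ[ε_i](τ₀,0), ∂Θ[ε_i]/∂τ_{jk}(τ₀,0)) and last row is the same data for ε. Then each f_ε lies in Γ_00 (i.e. f_ε(0)=0 and all second z-derivatives of f_ε vanish at 0), and the 2^g − N functions f_ε are linearly independent, hence form a basis of Γ_00. -/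

import Mathlib

open Complex BigOperators

noncomputable section

/-- The Siegel upper half-space: symmetric complex matrices with
positive-definite imaginary part. -/
def SiegelUpper (g : ℕ) : Set (Matrix (Fin g) (Fin g) ℂ) :=
  {τ | τ.IsSymm ∧ (Matrix.of fun i j => (τ i j).im).PosDef}

/-- The bilinear pairing vᵀ τ w. -/
def qform {g : ℕ} (τ : Matrix (Fin g) (Fin g) ℂ) (v w : Fin g → ℂ) : ℂ :=
  ∑ i, ∑ j, v i * τ i j * w j

/-- The dot product vᵀ w. -/
def dotc {g : ℕ} (v w : Fin g → ℂ) : ℂ := ∑ i, v i * w i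

/-- The Riemann theta function θ(τ,z). -/
def theta {g : ℕ} (τ : Matrix (Fin g) (Fin g) ℂ) (z : Fin g → ℂ) : ℂ :=
  ∑' n : Fin g → ℤ, Complex.exp ((Real.pi : ℂ) * Complex.I *
    (qform τ (fun i => (n i : ℂ)) (fun i => (n i : ℂ))
      + 2 * dotc (fun i => (n i : ℂ)) z))

/-- The theta function with characteristic [ε;δ] (entries of ε, δ in {0,1},
used via ε/2, δ/2). -/
def thetaChar {g : ℕ} (ε δ : Fin g → ℤ) (τ : Matrix (Fin g) (Fin g) ℂ)
    (z : Fin g → ℂ) : ℂ :=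
  ∑' n : Fin g → ℤ, Complex.exp ((Real.pi : ℂ) * Complex.I *
    (qform τ (fun i => (n i : ℂ) + (ε i : ℂ) / 2) (fun i => (n i : ℂ) + (ε i : ℂ) / 2)
      + 2 * dotc (fun i => (n i : ℂ) + (ε i : ℂ) / 2) (fun i => z i + (δ i : ℂ) / 2)))

/-- The second-order theta function Θ[ε](τ,z) = θ[ε;0](2τ,2z). -/
def theta2 {g : ℕ} (ε : Fin g → ℤ) (τ : Matrix (Fin g) (Fin g) ℂ)
    (z : Fin g → ℂ) : ℂ :=
  thetaChar ε 0 (Matrix.of fun i j => 2 * τ i j) (fun i => 2 * z i)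

/-- Lift of a mod-2 characteristic to an integer vector with entries in {0,1}. -/
def liftChar {g : ℕ} (ε : Fin g → ZMod 2) : Fin g → ℤ := fun i => ((ε i).val : ℤ)

/-- Directional derivative of a function ℂ^g → ℂ in the j-th coordinate. -/
def dirDeriv {g : ℕ} (j : Fin g) (f : (Fin g → ℂ) → ℂ) : (Fin g → ℂ) → ℂ :=
  fun z => deriv (fun t : ℂ => f (z + t • (Pi.single j 1 : Fin g → ℂ))) 0

/-- The symmetric elementary matrix E_{jk} + E_{kj} (= E_{jj} if j = k). -/
def symmUnit {g : ℕ} (j k : Fin g) : Matrix (Fin g) (Fin g) ℂ :=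
  Matrix.of fun a b => if (a = j ∧ b = k) ∨ (a = k ∧ b = j) then 1 else 0

theorem hasDerivAt_tsum_mul_exp {ι : Type*} (w a b : ι → ℂ) {r : ℝ} (hr : 0 < r)
    (h : Summable fun n => ‖w n‖ * Real.exp ((a n).re + r * ‖b n‖)) :
    HasDerivAt (fun t : ℂ => ∑' n, w n * exp (a n + t * b n))
      (∑' n, w n * b n * exp (a n)) 0 := by
  have hF : ∀ n, DifferentiableOn ℂ (fun t : ℂ => w n * exp (a n + t * b n))
      (Metric.ball 0 r) := fun n => by fun_prop
  have hle : ∀ n (t : ℂ), t ∈ Metric.ball (0 : ℂ) r →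
      ‖w n * exp (a n + t * b n)‖ ≤ ‖w n‖ * Real.exp ((a n).re + r * ‖b n‖) := by
    intro n t ht
    rw [mem_ball_zero_iff] at ht
    rw [norm_mul, Complex.norm_exp, add_re]
    gcongr
    calc (t * b n).re ≤ ‖t * b n‖ := re_le_norm _
      _ = ‖t‖ * ‖b n‖ := norm_mul _ _
      _ ≤ r * ‖b n‖ := by gcongr
  have h0 : (0 : ℂ) ∈ Metric.ball (0 : ℂ) r := Metric.mem_ball_self hr
  have hd := (differentiableOn_tsum_of_summable_norm h hF Metric.isOpen_ball hle).differentiableAt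
    (Metric.isOpen_ball.mem_nhds h0)
  have hderiv := hd.hasDerivAt
  rw [← (hasSum_deriv_of_summable_norm h hF Metric.isOpen_ball hle h0).tsum_eq] at hderiv
  refine hderiv.congr_deriv (tsum_congr fun n => ?_)
  have : HasDerivAt (fun t : ℂ => w n * exp (a n + t * b n))
      (w n * (exp (a n + 0 * b n) * (1 * b n))) 0 :=
    ((((hasDerivAt_id (0 : ℂ)).mul_const (b n)).const_add (a n)).cexp).const_mul (w n)
  rw [this.deriv]
  simp only [zero_mul, add_zero, one_mul]
  ring

theorem summable_pi_prod_of_nonneg {g : ℕ} {f : ℤ → ℝ} (h0 : ∀ n, 0 ≤ f n) (hf : Summable f) :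
    Summable fun n : Fin g → ℤ => ∏ i, f (n i) := by
  induction g with
  | zero => exact (hasSum_fintype _).summable
  | succ g ih =>
    rw [← (Fin.consEquiv fun _ : Fin (g + 1) => ℤ).summable_iff]
    refine (hf.mul_of_nonneg ih h0 fun n => Finset.prod_nonneg fun i _ => h0 _).congr ?_
    intro p
    simp [Fin.consEquiv, Fin.prod_univ_succ]

theorem summable_exp_neg_abs_int : Summable fun n : ℤ => Real.exp (-|(n : ℝ)|) := by
  apply Summable.of_nat_of_neg <;> simpa using Real.summable_exp_neg_nat

theorem summable_exp_neg_sum_abs (g : ℕ) :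
    Summable fun n : Fin g → ℤ => Real.exp (-∑ i, |(n i : ℝ)|) := by
  refine (summable_pi_prod_of_nonneg (fun n => (Real.exp_pos _).le)
    summable_exp_neg_abs_int).congr fun n => ?_
  rw [← Real.exp_sum, Finset.sum_neg_distrib]

theorem summable_exp_quadratic {g : ℕ} {c : ℝ} (hc : 0 < c) (K : ℝ) (s : Fin g → ℝ) :
    Summable fun n : Fin g → ℤ =>
      Real.exp (-c * ‖fun i => (n i : ℝ) + s i‖ ^ 2 + K * ‖fun i => (n i : ℝ) + s i‖) := by
  refine Summable.of_nonneg_of_le (fun n => (Real.exp_pos _).le) (fun n => ?_)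
    ((summable_exp_neg_sum_abs g).mul_left (Real.exp ((K + g) ^ 2 / (4 * c) + ∑ i, |s i|)))
  rw [← Real.exp_add, Real.exp_le_exp]
  set y := ‖fun i => (n i : ℝ) + s i‖
  have h1 : ∑ i, |(n i : ℝ)| ≤ g * y + ∑ i, |s i| := by
    calc ∑ i, |(n i : ℝ)| ≤ ∑ i, (y + |s i|) := by
          refine Finset.sum_le_sum fun i _ => ?_
          have h2 : |(n i : ℝ) + s i| ≤ y := norm_le_pi_norm (fun i => (n i : ℝ) + s i) i
          have h3 := abs_sub ((n i : ℝ) + s i) (s i)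
          rw [add_sub_cancel_right] at h3
          linarith
      _ = _ := by simp [Finset.sum_add_distrib]
  have h4 : (K + g) * y - c * y ^ 2 ≤ (K + g) ^ 2 / (4 * c) := by
    rw [le_div_iff₀ (by positivity)]
    nlinarith [sq_nonneg (2 * c * y - (K + g))]
  linarith

open scoped Matrix in
theorem Matrix.PosDef.exists_pos_mul_sq_norm_le {g : ℕ} {A : Matrix (Fin g) (Fin g) ℝ}
    (hA : A.PosDef) : ∃ c > 0, ∀ x : Fin g → ℝ, c * ‖x‖ ^ 2 ≤ x ⬝ᵥ A *ᵥ x := by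
  have hpos : ∀ x : Fin g → ℝ, x ≠ 0 → 0 < x ⬝ᵥ A *ᵥ x := fun x hx => by
    simpa using hA.dotProduct_mulVec_pos hx
  have hcont : Continuous fun x : Fin g → ℝ => x ⬝ᵥ A *ᵥ x := by
    simp only [dotProduct, Matrix.mulVec]; fun_prop
  obtain ⟨c, hc, hle⟩ : ∃ c > 0, ∀ x ∈ Metric.sphere (0 : Fin g → ℝ) 1, c ≤ x ⬝ᵥ A *ᵥ x := by
    rcases (Metric.sphere (0 : Fin g → ℝ) 1).eq_empty_or_nonempty with h | h
    · exact ⟨1, one_pos, by simp [h]⟩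
    · obtain ⟨x, hx, hmin⟩ := (isCompact_sphere (0 : Fin g → ℝ) 1).exists_isMinOn h
        hcont.continuousOn
      exact ⟨_, hpos x (ne_zero_of_mem_unit_sphere ⟨x, hx⟩), hmin⟩
  refine ⟨c, hc, fun x => ?_⟩
  by_cases hx : x = 0
  · simp [hx]
  have hn : 0 < ‖x‖ := norm_pos_iff.2 hx
  have h := hle (‖x‖⁻¹ • x) (by simp [norm_smul, hn.ne'])
  rw [Matrix.mulVec_smul, smul_dotProduct, dotProduct_smul, smul_eq_mul, smul_eq_mul] at h
  calc c * ‖x‖ ^ 2 ≤ ‖x‖⁻¹ * (‖x‖⁻¹ * x ⬝ᵥ A *ᵥ x) * ‖x‖ ^ 2 := by gcongr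
    _ = _ := by field_simp

/-- The point `n + ε / 2` of the shifted lattice. -/
def charPoint {g : ℕ} (ε n : Fin g → ℤ) : Fin g → ℝ := fun i => (n i : ℝ) + (ε i : ℝ) / 2

/-- The exponent of the term of `theta2` at the lattice point `x`. -/
def thetaExponent {g : ℕ} (τ : Matrix (Fin g) (Fin g) ℂ) (z : Fin g → ℂ) (x : Fin g → ℝ) : ℂ :=
  2 * Real.pi * I * (qform τ (fun i => (x i : ℂ)) (fun i => (x i : ℂ)) +
    2 * dotc (fun i => (x i : ℂ)) z)

theorem theta2_eq_tsum {g : ℕ} (ε : Fin g → ℤ) (τ : Matrix (Fin g) (Fin g) ℂ) (z : Fin g → ℂ) :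
    theta2 ε τ z = ∑' n, exp (thetaExponent τ z (charPoint ε n)) := by
  refine tsum_congr fun n => congrArg exp ?_
  have h1 : ∀ v : Fin g → ℂ, qform (Matrix.of fun i j => 2 * τ i j) v v = 2 * qform τ v v := by
    intro v
    simp only [qform, Finset.mul_sum, Matrix.of_apply]
    exact Finset.sum_congr rfl fun i _ => Finset.sum_congr rfl fun j _ => by ring
  have h2 : ∀ v : Fin g → ℂ, dotc v (fun i => 2 * z i + ((0 : Fin g → ℤ) i : ℂ) / 2) =
      2 * dotc v z := by
    intro v
    simp only [dotc, Finset.mul_sum, Pi.zero_apply, Int.cast_zero, zero_div, add_zero]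
    exact Finset.sum_congr rfl fun i _ => by ring
  rw [h1, h2]
  simp only [thetaExponent, charPoint]
  push_cast
  ring

theorem thetaExponent_add_single {g : ℕ} (τ : Matrix (Fin g) (Fin g) ℂ) (z : Fin g → ℂ)
    (x : Fin g → ℝ) (k : Fin g) (t : ℂ) :
    thetaExponent τ (z + t • (Pi.single k 1 : Fin g → ℂ)) x =
      thetaExponent τ z x + t * (4 * Real.pi * I * x k) := by
  have h : dotc (fun i => (x i : ℂ)) (z + t • (Pi.single k 1 : Fin g → ℂ)) =
      dotc (fun i => (x i : ℂ)) z + t * x k := by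
    simp [dotc, mul_add, Finset.sum_add_distrib, Pi.single_apply, mul_comm]
  rw [thetaExponent, h, thetaExponent]
  ring

theorem qform_symmUnit {g : ℕ} (j k : Fin g) (v : Fin g → ℂ) :
    qform (symmUnit j k) v v = (if j = k then 1 else 2) * (v j * v k) := by
  have h : ∀ a b, v a * symmUnit j k a b * v b =
      (if a = j then if b = k then v j * v k else 0 else 0) +
        if j = k then 0 else if a = k then if b = j then v j * v k else 0 else 0 := by
    intro a b
    simp only [symmUnit, Matrix.of_apply]
    grind
  simp only [qform, h, Finset.sum_add_distrib]
  split_ifs with hjk <;> simp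
  ring

theorem thetaExponent_add_symmUnit {g : ℕ} (τ : Matrix (Fin g) (Fin g) ℂ) (z : Fin g → ℂ)
    (x : Fin g → ℝ) (j k : Fin g) (t : ℂ) :
    thetaExponent (τ + t • symmUnit j k) z x =
      thetaExponent τ z x + t * (2 * Real.pi * I * ((if j = k then 1 else 2) * (x j * x k))) := by
  have h : ∀ v, qform (τ + t • symmUnit j k) v v = qform τ v v + t * qform (symmUnit j k) v v := by
    intro v
    simp only [qform, Finset.mul_sum, ← Finset.sum_add_distrib, Matrix.add_apply,
      Matrix.smul_apply, smul_eq_mul]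
    exact Finset.sum_congr rfl fun a _ => Finset.sum_congr rfl fun b _ => by ring
  rw [thetaExponent, h, qform_symmUnit, thetaExponent]
  ring

theorem re_thetaExponent_le {g : ℕ} {τ : Matrix (Fin g) (Fin g) ℂ} {c : ℝ}
    (hc : ∀ x : Fin g → ℝ, c * ‖x‖ ^ 2 ≤
      dotProduct x (Matrix.mulVec (Matrix.of fun i j => (τ i j).im) x))
    (z : Fin g → ℂ) (x : Fin g → ℝ) :
    (thetaExponent τ z x).re ≤
      -(2 * Real.pi * c) * ‖x‖ ^ 2 + (4 * Real.pi * ∑ i, ‖z i‖) * ‖x‖ := by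
  have h1 : (qform τ (fun i => (x i : ℂ)) (fun i => (x i : ℂ))).im =
      dotProduct x (Matrix.mulVec (Matrix.of fun i j => (τ i j).im) x) := by
    simp only [qform, dotProduct, Matrix.mulVec, im_sum, Finset.mul_sum, Matrix.of_apply]
    refine Finset.sum_congr rfl fun i _ => Finset.sum_congr rfl fun j _ => ?_
    simp [mul_assoc]
  have h2 : -(dotc (fun i => (x i : ℂ)) z).im ≤ (∑ i, ‖z i‖) * ‖x‖ := by
    rw [dotc, im_sum, ← Finset.sum_neg_distrib, Finset.sum_mul]
    refine Finset.sum_le_sum fun i _ => ?_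
    calc -((x i : ℂ) * z i).im ≤ |((x i : ℂ) * z i).im| := neg_le_abs _
      _ ≤ ‖(x i : ℂ) * z i‖ := abs_im_le_norm _
      _ = ‖z i‖ * ‖x i‖ := by rw [norm_mul, norm_real, mul_comm]
      _ ≤ ‖z i‖ * ‖x‖ := by gcongr; exact norm_le_pi_norm x i
  have h3 : (thetaExponent τ z x).re = 2 * Real.pi *
      -(qform τ (fun i => (x i : ℂ)) (fun i => (x i : ℂ))).im +
        4 * Real.pi * -(dotc (fun i => (x i : ℂ)) z).im := by
    simp [thetaExponent]
    ring
  rw [h3, h1]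
  have h4 := mul_le_mul_of_nonneg_left (hc x) (by positivity : 0 ≤ 2 * Real.pi)
  have h5 := mul_le_mul_of_nonneg_left h2 (by positivity : 0 ≤ 4 * Real.pi)
  linarith

theorem exists_summable_exp_re_thetaExponent {g : ℕ} {τ : Matrix (Fin g) (Fin g) ℂ}
    (hτ : τ ∈ SiegelUpper g) : ∃ c > 0, ∀ (ε : Fin g → ℤ) (z : Fin g → ℂ) (K : ℝ),
      Summable fun n => Real.exp ((thetaExponent τ z (charPoint ε n)).re +
        c * ‖charPoint ε n‖ ^ 2 + K * ‖charPoint ε n‖) := by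
  obtain ⟨c, hc, hle⟩ := hτ.2.exists_pos_mul_sq_norm_le
  refine ⟨Real.pi * c, by positivity, fun ε z K => ?_⟩
  refine Summable.of_nonneg_of_le (fun n => (Real.exp_pos _).le) (fun n => ?_)
    (summable_exp_quadratic (by positivity : 0 < Real.pi * c)
      (4 * Real.pi * ∑ i, ‖z i‖ + K) fun i => (ε i : ℝ) / 2)
  rw [Real.exp_le_exp]
  have h := re_thetaExponent_le hle z (charPoint ε n)
  change _ ≤ -(Real.pi * c) * ‖charPoint ε n‖ ^ 2 + _ * ‖charPoint ε n‖
  linarith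

theorem hasDerivAt_tsum_thetaExponent_add_single {g : ℕ} {τ : Matrix (Fin g) (Fin g) ℂ}
    (hτ : τ ∈ SiegelUpper g) (ε : Fin g → ℤ) (z : Fin g → ℂ) (k : Fin g)
    (w : (Fin g → ℝ) → ℂ) {K : ℝ} (hw : ∀ x, ‖w x‖ ≤ Real.exp (K * ‖x‖)) :
    HasDerivAt (fun t : ℂ => ∑' n, w (charPoint ε n) *
        exp (thetaExponent τ (z + t • (Pi.single k 1 : Fin g → ℂ)) (charPoint ε n)))
      (∑' n, w (charPoint ε n) * (4 * Real.pi * I * charPoint ε n k) *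
        exp (thetaExponent τ z (charPoint ε n))) 0 := by
  simp only [thetaExponent_add_single]
  obtain ⟨c, hc, hs⟩ := exists_summable_exp_re_thetaExponent hτ
  refine hasDerivAt_tsum_mul_exp _ _ _ one_pos ?_
  refine Summable.of_nonneg_of_le (fun n => by positivity) (fun n => ?_)
    (hs ε z (K + 4 * Real.pi))
  set x := charPoint ε n
  have hb : ‖(4 * Real.pi * I * x k : ℂ)‖ ≤ 4 * Real.pi * ‖x‖ := by
    have := norm_le_pi_norm x k
    simp only [norm_mul, norm_I, norm_real, Complex.norm_ofNat, mul_one,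
      Real.norm_of_nonneg Real.pi_pos.le]
    gcongr
  calc _ ≤ Real.exp (K * ‖x‖) * Real.exp ((thetaExponent τ z x).re + 1 * (4 * Real.pi * ‖x‖)) := by
        gcongr
        exact hw x
    _ ≤ _ := by
        rw [← Real.exp_add, Real.exp_le_exp]
        nlinarith [mul_nonneg hc.le (sq_nonneg ‖x‖)]

theorem hasDerivAt_theta2_add_single {g : ℕ} {τ : Matrix (Fin g) (Fin g) ℂ} (hτ : τ ∈ SiegelUpper g)
    (ε : Fin g → ℤ) (z : Fin g → ℂ) (k : Fin g) :
    HasDerivAt (fun t : ℂ => theta2 ε τ (z + t • (Pi.single k 1 : Fin g → ℂ)))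
      (∑' n, 4 * Real.pi * I * charPoint ε n k * exp (thetaExponent τ z (charPoint ε n))) 0 := by
  simpa [theta2_eq_tsum] using hasDerivAt_tsum_thetaExponent_add_single hτ ε z k (fun _ => 1)
    (K := 0) (by simp)

theorem hasDerivAt_dirDeriv_theta2 {g : ℕ} {τ : Matrix (Fin g) (Fin g) ℂ} (hτ : τ ∈ SiegelUpper g)
    (ε : Fin g → ℤ) (z : Fin g → ℂ) (j k : Fin g) :
    HasDerivAt (fun t : ℂ => dirDeriv k (theta2 ε τ) (z + t • (Pi.single j 1 : Fin g → ℂ)))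
      ((4 * Real.pi * I) ^ 2 * ∑' n, (charPoint ε n j * charPoint ε n k : ℂ) *
        exp (thetaExponent τ z (charPoint ε n))) 0 := by
  have h := hasDerivAt_tsum_thetaExponent_add_single hτ ε z j
    (fun x => 4 * Real.pi * I * x k) (K := 4 * Real.pi) fun x => by
      have := norm_le_pi_norm x k
      simp only [norm_mul, norm_I, norm_real, Complex.norm_ofNat, mul_one,
        Real.norm_of_nonneg Real.pi_pos.le]
      calc 4 * Real.pi * ‖x k‖ ≤ 4 * Real.pi * ‖x‖ := by gcongr
        _ ≤ _ := by linarith [Real.add_one_le_exp (4 * Real.pi * ‖x‖)]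
  simp only [dirDeriv, (hasDerivAt_theta2_add_single hτ ε _ k).deriv]
  refine h.congr_deriv ?_
  rw [← tsum_mul_left]
  exact tsum_congr fun n => by ring

theorem hasDerivAt_theta2_add_symmUnit {g : ℕ} {τ : Matrix (Fin g) (Fin g) ℂ}
    (hτ : τ ∈ SiegelUpper g) (ε : Fin g → ℤ) (z : Fin g → ℂ) (j k : Fin g) :
    HasDerivAt (fun t : ℂ => theta2 ε (τ + t • symmUnit j k) z)
      (2 * Real.pi * I * (if j = k then 1 else 2) *
        ∑' n, (charPoint ε n j * charPoint ε n k : ℂ) *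
          exp (thetaExponent τ z (charPoint ε n))) 0 := by
  obtain ⟨c, hc, hs⟩ := exists_summable_exp_re_thetaExponent hτ
  have h := hasDerivAt_tsum_mul_exp (fun _ => 1) (fun n => thetaExponent τ z (charPoint ε n))
    (fun n => 2 * Real.pi * I *
      ((if j = k then 1 else 2) * (charPoint ε n j * charPoint ε n k)))
    (r := c / (4 * Real.pi)) (by positivity) ?_
  · simp only [one_mul] at h
    simp only [theta2_eq_tsum, thetaExponent_add_symmUnit]
    refine h.congr_deriv ?_
    rw [← tsum_mul_left]
    exact tsum_congr fun n => by ring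
  · refine Summable.of_nonneg_of_le (fun n => by positivity) (fun n => ?_) (hs ε z 0)
    set x := charPoint ε n
    have hb : ‖(2 * Real.pi * I * ((if j = k then 1 else 2) * (x j * x k)) : ℂ)‖ ≤
        2 * Real.pi * (2 * (‖x‖ * ‖x‖)) := by
      have hj := norm_le_pi_norm x j
      have hk := norm_le_pi_norm x k
      have h2 : ‖(if j = k then 1 else 2 : ℂ)‖ ≤ 2 := by split_ifs <;> norm_num
      simp only [norm_mul, norm_I, norm_real, Complex.norm_ofNat, mul_one,
        Real.norm_of_nonneg Real.pi_pos.le] at h2 ⊢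
      gcongr
    rw [norm_one, one_mul, Real.exp_le_exp, zero_mul, add_zero]
    refine (add_le_add_iff_left _).2 ?_
    calc _ ≤ c / (4 * Real.pi) * (2 * Real.pi * (2 * (‖x‖ * ‖x‖))) := by gcongr
      _ = _ := by field_simp; norm_num

/-- The heat equation for the second order theta functions. -/
theorem dirDeriv_dirDeriv_theta2 {g : ℕ} {τ : Matrix (Fin g) (Fin g) ℂ} (hτ : τ ∈ SiegelUpper g)
    (ε : Fin g → ℤ) (z : Fin g → ℂ) (j k : Fin g) :
    dirDeriv j (dirDeriv k (theta2 ε τ)) z = 4 * Real.pi * I * (if j = k then 2 else 1) *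
      deriv (fun t : ℂ => theta2 ε (τ + t • symmUnit j k) z) 0 := by
  rw [dirDeriv, (hasDerivAt_dirDeriv_theta2 hτ ε z j k).deriv,
    (hasDerivAt_theta2_add_symmUnit hτ ε z j k).deriv]
  split_ifs <;> ring

theorem dirDeriv_dirDeriv_sum_mul_theta2 {g : ℕ} {ι : Type*} [Fintype ι]
    {τ : Matrix (Fin g) (Fin g) ℂ} (hτ : τ ∈ SiegelUpper g) (a : ι → ℂ) (ε : ι → Fin g → ℤ) (z : Fin g → ℂ)
    (j k : Fin g) : dirDeriv j (dirDeriv k fun z => ∑ i, a i * theta2 (ε i) τ z) z =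
      ∑ i, a i * dirDeriv j (dirDeriv k (theta2 (ε i) τ)) z := by
  have h : (dirDeriv k fun z => ∑ i, a i * theta2 (ε i) τ z) =
      fun z => ∑ i, a i * dirDeriv k (theta2 (ε i) τ) z := by
    funext z
    simp only [dirDeriv, (hasDerivAt_theta2_add_single hτ _ z k).deriv]
    exact (HasDerivAt.fun_sum fun i _ =>
      (hasDerivAt_theta2_add_single hτ (ε i) z k).const_mul (a i)).deriv
  rw [h]
  conv_lhs => rw [dirDeriv]
  rw [(HasDerivAt.fun_sum fun i _ =>
    (hasDerivAt_dirDeriv_theta2 hτ (ε i) z j k).const_mul (a i)).deriv]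
  refine Finset.sum_congr rfl fun i _ => ?_
  conv_rhs => rw [dirDeriv, (hasDerivAt_dirDeriv_theta2 hτ (ε i) z j k).deriv]

theorem symmUnit_comm {g : ℕ} (j k : Fin g) : symmUnit j k = symmUnit k j := by
  ext a b
  simp only [symmUnit, Matrix.of_apply, or_comm]

/-- The bordered determinant with rows `(φ (εs i), D (εs i))` and last row `(φ ε, D ε)`. -/
def borderedDet {K ι : Type*} [Field K] {N : ℕ} (D : ι → Fin N → K) (εs : Fin N → ι)
    (φ : ι → K) (ε : ι) : K :=
  Matrix.det (Matrix.of fun (i : Fin (N + 1)) (c : Fin (N + 1)) =>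
    (fun ε' : ι => Fin.cases (φ ε') (fun c' : Fin N => D ε' c') c)
      (Fin.lastCases ε (fun i' => εs i') i))

theorem borderedDet_column {K ι : Type*} [Field K] {N : ℕ} (D : ι → Fin N → K) (εs : Fin N → ι)
    (ε : ι) (c : Fin N) : borderedDet D εs (fun ε' => D ε' c) ε = 0 :=
  Matrix.det_zero_of_column_eq (i := 0) (j := c.succ) (Fin.succ_ne_zero c).symm fun i => by simp

theorem exists_borderedDet_eq {K ι : Type*} [Field K] {N : ℕ} (D : ι → Fin N → K)
    (εs : Fin N → ι) (ε : ι) : ∃ κ : Fin N → K, ∀ φ : ι → K, borderedDet D εs φ ε =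
      (-1) ^ N * (Matrix.of fun i => D (εs i)).det * φ ε + ∑ i, κ i * φ (εs i) := by
  refine ⟨fun i => (-1) ^ (i : ℕ) * Matrix.det
    ((Matrix.of fun (i : Fin (N + 1)) (c : Fin N) => D (Fin.lastCases ε εs i) c).submatrix
      i.castSucc.succAbove id), fun φ => ?_⟩
  rw [borderedDet, Matrix.det_succ_column_zero, Fin.sum_univ_castSucc, add_comm]
  congr 1
  · simp only [Fin.val_last, Matrix.of_apply, Fin.lastCases_last, Fin.cases_zero,
      Fin.succAbove_last]
    rw [mul_right_comm]
    congr 2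
    refine congrArg Matrix.det ?_
    ext i c
    simp
  · refine Finset.sum_congr rfl fun i _ => ?_
    simp only [Fin.val_castSucc, Matrix.of_apply, Fin.lastCases_castSucc, Fin.cases_zero]
    rw [mul_right_comm]
    rfl

section

variable {K ι : Type*} [Field K] [DecidableEq ι] {N : ℕ} (D : ι → Fin N → K)
  (εs : Fin N → ι)

/-- The coefficients of `borderedDet D εs φ ε` as a linear form in `φ`. -/
def borderedCoeff (ε : ι) : ι → K := fun ε' => borderedDet D εs (Pi.single ε' 1) ε

theorem borderedCoeff_of_notMem {ε ε' : ι} (h : ε' ∉ Set.range εs) :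
    borderedCoeff D εs ε ε' =
      (-1) ^ N * (Matrix.of fun i => D (εs i)).det * if ε = ε' then 1 else 0 := by
  obtain ⟨κ, hκ⟩ := exists_borderedDet_eq D εs ε
  have h0 : ∀ i, (Pi.single ε' 1 : ι → K) (εs i) = 0 :=
    fun i => Pi.single_eq_of_ne (fun e => h ⟨i, e⟩) _
  rw [borderedCoeff, hκ]
  simp only [h0, mul_zero, Finset.sum_const_zero, add_zero, Pi.single_apply]

variable [Fintype ι]

theorem borderedDet_eq_sum (φ : ι → K) (ε : ι) :
    borderedDet D εs φ ε = ∑ ε', borderedCoeff D εs ε ε' * φ ε' := by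
  obtain ⟨κ, hκ⟩ := exists_borderedDet_eq D εs ε
  simp only [borderedCoeff, hκ, add_mul, Finset.sum_add_distrib, Finset.sum_mul]
  rw [Finset.sum_comm]
  simp [Pi.single_apply, mul_assoc]

theorem sum_borderedCoeff_mul (ε : ι) (c : Fin N) :
    ∑ ε', borderedCoeff D εs ε ε' * D ε' c = 0 := by
  rw [← borderedDet_eq_sum, borderedDet_column]

variable {D εs}

theorem linearIndependent_borderedCoeff (hD : (Matrix.of fun i => D (εs i)).det ≠ 0) :
    LinearIndependent K fun ε : {ε // ε ∉ Set.range εs} => borderedCoeff D εs ε := by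
  classical
  rw [Fintype.linearIndependent_iff]
  intro a ha ε
  have h := congrFun ha ε.1
  simp only [Finset.sum_apply, Pi.smul_apply, smul_eq_mul, borderedCoeff_of_notMem D εs ε.2,
    Subtype.coe_inj, mul_ite, mul_one, mul_zero, Finset.sum_ite_eq', Finset.mem_univ, if_true,
    Pi.zero_apply] at h
  exact (mul_eq_zero.1 h).resolve_right (mul_ne_zero (by simp) hD)

theorem mem_span_borderedCoeff (hD : (Matrix.of fun i => D (εs i)).det ≠ 0) {a : ι → K}
    (ha : ∀ c, ∑ ε, a ε * D ε c = 0) :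
    a ∈ Submodule.span K
      (Set.range fun ε : {ε // ε ∉ Set.range εs} => borderedCoeff D εs ε) := by
  classical
  set d : K := (-1) ^ N * (Matrix.of fun i => D (εs i)).det with hd
  have hd0 : d ≠ 0 := mul_ne_zero (by simp) hD
  have hinj : Function.Injective εs := by
    intro i j hij
    by_contra hne
    exact hD (Matrix.det_zero_of_row_eq hne (by ext; simp [hij]))
  set b : ι → K := a - ∑ ε : {ε // ε ∉ Set.range εs}, (a ε / d) • borderedCoeff D εs ε with hb
  have hboff : ∀ ε ∉ Set.range εs, b ε = 0 := by
    intro ε hε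
    have h : ∀ ε' : {ε // ε ∉ Set.range εs},
        (a ε' / d) * borderedCoeff D εs ε' ε = if ε' = ⟨ε, hε⟩ then a ε else 0 := by
      intro ε'
      rw [borderedCoeff_of_notMem D εs hε, ← hd]
      by_cases he : ε' = ⟨ε, hε⟩
      · subst he
        simp [hd0]
      · have : (ε' : ι) ≠ ε := fun e => he (Subtype.ext e)
        simp [he, this]
    simp [hb, h]
  have hbD : ∀ c, ∑ ε, b ε * D ε c = 0 := by
    intro c
    simp only [hb, Pi.sub_apply, sub_mul, Finset.sum_sub_distrib, ha, Finset.sum_apply,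
      Finset.sum_mul, Pi.smul_apply, smul_eq_mul]
    rw [Finset.sum_comm]
    simp only [mul_assoc, ← Finset.mul_sum, sum_borderedCoeff_mul, mul_zero,
      Finset.sum_const_zero, sub_zero]
  have hbεs : b ∘ εs = 0 := by
    refine Matrix.eq_zero_of_vecMul_eq_zero hD (funext fun c => ?_)
    simp only [Matrix.vecMul, dotProduct, Matrix.of_apply, Function.comp_apply, Pi.zero_apply]
    rw [← hbD c]
    exact Fintype.sum_of_injective εs hinj _ _ (fun ε hε => by simp [hboff ε hε]) fun _ => rfl
  have hb0 : b = 0 := by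
    funext ε
    by_cases hε : ε ∈ Set.range εs
    · obtain ⟨i, rfl⟩ := hε
      exact congrFun hbεs i
    · exact hboff ε hε
  rw [sub_eq_zero.1 hb0]
  exact Submodule.sum_mem _ fun ε _ => Submodule.smul_mem _ _ (Submodule.subset_span ⟨ε, rfl⟩)

end

/-- the determinantal construction of a basis of Γ_00 ⊂ |2Θ_{τ0}|.
If the N×N matrix of theta constants and their τ-derivatives (N = 1 + g(g+1)/2)
built from ε_1,…,ε_N has nonzero determinant, then the (N+1)×(N+1) determinants
f_ε (for ε outside {ε_1,…,ε_N}) vanish to order ≥ 4 at z = 0, are linearly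
independent, and span Γ_00, hence form a basis of Γ_00. -/
theorem basis_of_Gamma00 {g N : ℕ} (hN : N = 1 + g * (g + 1) / 2)
    (τ0 : Matrix (Fin g) (Fin g) ℂ) (hτ0 : τ0 ∈ SiegelUpper g)
    (hindep : LinearIndependent ℂ
      (fun ε : Fin g → ZMod 2 => fun z => theta2 (liftChar ε) τ0 z))
    (eC : Option {p : Fin g × Fin g // p.1 ≤ p.2} ≃ Fin N)
    (εs : Fin N → (Fin g → ZMod 2)) :
    let tauDeriv : Fin g → Fin g → (Fin g → ZMod 2) → ℂ := fun j k ε =>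
      deriv (fun t : ℂ => theta2 (liftChar ε) (τ0 + t • symmUnit j k) 0) 0
    let M : Matrix (Fin N) (Fin N) ℂ := Matrix.of fun i c =>
      match eC.symm c with
      | none => theta2 (liftChar (εs i)) τ0 0
      | some p => tauDeriv p.1.1 p.1.2 (εs i)
    let fE : (Fin g → ZMod 2) → (Fin g → ℂ) → ℂ := fun ε z =>
      Matrix.det (Matrix.of fun (i : Fin (N + 1)) (c : Fin (N + 1)) =>
        (fun ε' : Fin g → ZMod 2 =>
          Fin.cases (theta2 (liftChar ε') τ0 z)
            (fun c' : Fin N =>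
              match eC.symm c' with
              | none => theta2 (liftChar ε') τ0 0
              | some p => tauDeriv p.1.1 p.1.2 ε') c)
        (Fin.lastCases ε (fun i' => εs i') i))
    M.det ≠ 0 →
    (∀ ε ∉ Set.range εs,
      fE ε 0 = 0 ∧ ∀ j k : Fin g, dirDeriv j (dirDeriv k (fE ε)) 0 = 0) ∧
    LinearIndependent ℂ (fun ε : {ε : Fin g → ZMod 2 // ε ∉ Set.range εs} => fE ε) ∧
    (∀ f : (Fin g → ℂ) → ℂ,
      f ∈ Submodule.span ℂ
        (Set.range (fun ε : Fin g → ZMod 2 => fun z => theta2 (liftChar ε) τ0 z)) →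
      f 0 = 0 → (∀ j k : Fin g, dirDeriv j (dirDeriv k f) 0 = 0) →
      f ∈ Submodule.span ℂ
        (Set.range (fun ε : {ε : Fin g → ZMod 2 // ε ∉ Set.range εs} => fE ε))) := by
  intro tauDeriv M fE hM
  let Θ : (Fin g → ZMod 2) → (Fin g → ℂ) → ℂ := fun ε => theta2 (liftChar ε) τ0
  let D : (Fin g → ZMod 2) → Fin N → ℂ := fun ε c =>
    match eC.symm c with
    | none => theta2 (liftChar ε) τ0 0
    | some p => tauDeriv p.1.1 p.1.2 ε
  have hD : (Matrix.of fun i => D (εs i)).det ≠ 0 := hM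
  have hfE : ∀ ε, fE ε = Fintype.linearCombination ℂ Θ (borderedCoeff D εs ε) := by
    intro ε
    funext z
    rw [Fintype.linearCombination_apply, Finset.sum_apply]
    exact borderedDet_eq_sum D εs (fun ε' => Θ ε' z) ε
  have hD_none : ∀ ε, D ε (eC none) = Θ ε 0 := fun ε => by simp [D, Θ]
  have hD_some : ∀ ε p, D ε (eC (some p)) = tauDeriv p.1.1 p.1.2 ε := fun ε p => by simp [D]
  have hΓ : ∀ a : (Fin g → ZMod 2) → ℂ, (Fintype.linearCombination ℂ Θ a 0 = 0 ∧
      ∀ j k, dirDeriv j (dirDeriv k (Fintype.linearCombination ℂ Θ a)) 0 = 0) ↔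
        ∀ c, ∑ ε, a ε * D ε c = 0 := by
    intro a
    have hcomb : Fintype.linearCombination ℂ Θ a = fun z => ∑ ε, a ε * Θ ε z := by
      funext z
      simp [Fintype.linearCombination_apply]
    have hdir : ∀ j k, dirDeriv j (dirDeriv k (Fintype.linearCombination ℂ Θ a)) 0 = 0 ↔
        ∑ ε, a ε * tauDeriv j k ε = 0 := by
      intro j k
      have hconst : (4 * Real.pi * I * (if j = k then 2 else 1) : ℂ) ≠ 0 := by
        split_ifs <;> simp [Real.pi_ne_zero]
      refine Iff.trans ?_ (mul_eq_zero_iff_left hconst)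
      rw [hcomb, dirDeriv_dirDeriv_sum_mul_theta2 hτ0 a liftChar, Finset.mul_sum]
      refine Eq.congr_left (Finset.sum_congr rfl fun ε _ => ?_)
      rw [dirDeriv_dirDeriv_theta2 hτ0]
      ring
    simp only [hdir]
    rw [hcomb]
    refine ⟨fun ⟨h0, h2⟩ c => ?_, fun h => ⟨?_, fun j k => ?_⟩⟩
    · obtain ⟨o, rfl⟩ := eC.surjective c
      cases o with
      | none => simpa only [hD_none] using h0
      | some p => simpa only [hD_some] using h2 p.1.1 p.1.2
    · simpa only [hD_none] using h (eC none)
    · rcases le_total j k with hjk | hjk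
      · simpa only [hD_some] using h (eC (some ⟨(j, k), hjk⟩))
      · simpa only [hD_some, tauDeriv, symmUnit_comm k j] using h (eC (some ⟨(k, j), hjk⟩))
  refine ⟨fun ε _ => ?_, ?_, fun f hf h0 h2 => ?_⟩
  · rw [hfE]
    exact (hΓ _).2 (sum_borderedCoeff_mul D εs ε)
  · simp only [hfE]
    exact (linearIndependent_borderedCoeff hD).map' (Fintype.linearCombination ℂ Θ)
      (LinearMap.ker_eq_bot.2 hindep.fintypeLinearCombination_injective)
  · change f ∈ Submodule.span ℂ (Set.range Θ) at hf
    rw [← Fintype.range_linearCombination] at hf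
    obtain ⟨a, rfl⟩ := hf
    have h := Submodule.mem_map_of_mem (f := Fintype.linearCombination ℂ Θ)
      (mem_span_borderedCoeff hD ((hΓ a).1 ⟨h0, h2⟩))
    rw [Submodule.map_span, ← Set.range_comp] at h
    simpa only [hfE, Function.comp_def] using h
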